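/- arXiv:math/0601124 — 2 statements merged into one kernel-verified Lean document; each statement's English description precedes it below -/
import Mathlib

section
/- (Moving particle lemma.) Let B ≥ 0, L ≥ 2, and let α : {1, …, L} → [−B, B]. Let μ be the product Bernoulli measure on {0,1}^{{1,…,L}} with μ(η_x = 1) = e^{α_x}/(1 + e^{α_x}), or this measure conditioned on the total number of particles Σ_{x=1}^{L} η_x = N for any 0 ≤ N ≤ L. Then for every function f : {0,1}^{{1,…,L}} → ℝ, ∫ (f(T_{1,L}η) − f(η))² dμ(η) ≤ e^{13B} · L · Σ_{x=1}^{L−1} ∫ (∇_{x,x+1} f)² dμ(η). -/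
noncomputable section

/-- `T_{xy}η`: the configuration (given by its set of occupied sites) with the occupation
numbers at `x` and `y` exchanged. -/
def exch (x y : ℕ) (S : Finset ℕ) : Finset ℕ := S.image (Equiv.swap x y)

/-- `∇_{xy} f (η) = f(T_{xy}η) - f(η)`. -/
def grad (x y : ℕ) (f : Finset ℕ → ℝ) (S : Finset ℕ) : ℝ := f (exch x y S) - f S

/-- Unnormalized weight `exp(∑_{x ∈ S} α_x)` of a configuration; for the product Bernoulli
measure with `μ(η_x = 1) = e^{α_x}/(1+e^{α_x})` the probability of a configuration `S ⊆ Λ`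
is proportional to this weight. -/
def wt (α : ℕ → ℝ) (S : Finset ℕ) : ℝ := Real.exp (∑ x ∈ S, α x)

/-- Expectation under the product Bernoulli measure on `{0,1}^{{1,…,L}}` with
`μ(η_x = 1) = e^{α_x}/(1+e^{α_x})`. -/
def prodE (L : ℕ) (α : ℕ → ℝ) (g : Finset ℕ → ℝ) : ℝ :=
  (∑ S ∈ (Finset.Icc 1 L).powerset, wt α S * g S) / ∑ S ∈ (Finset.Icc 1 L).powerset, wt α S

/-- Expectation under that product Bernoulli measure conditioned on the total particle
number `∑_{x=1}^L η_x = N`. -/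
def canonE (L N : ℕ) (α : ℕ → ℝ) (g : Finset ℕ → ℝ) : ℝ :=
  (∑ S ∈ (Finset.Icc 1 L).powersetCard N, wt α S * g S) /
    ∑ S ∈ (Finset.Icc 1 L).powersetCard N, wt α S

theorem mem_exch {a b x : ℕ} {S : Finset ℕ} :
    x ∈ exch a b S ↔ (if x = a then b else if x = b then a else x) ∈ S := by
  rw [← Equiv.swap_apply_def, exch, Finset.mem_image]
  constructor
  · rintro ⟨y, hy, rfl⟩
    simpa using hy
  · intro h
    exact ⟨_, h, by simp⟩

theorem exch_exch (a b : ℕ) (S : Finset ℕ) : exch a b (exch a b S) = S := by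
  ext x
  simp only [mem_exch]
  grind

theorem exch_eq_self {a b : ℕ} {S : Finset ℕ} (h : a ∈ S ↔ b ∈ S) : exch a b S = S := by
  ext x
  rw [mem_exch]
  grind

theorem exch_exch_of_notMem {a b c : ℕ} {S : Finset ℕ} (hac : a ≠ c)
    (hbc : b ≠ c) (hb : b ∉ S) (hc : c ∉ S) : exch b c (exch a b S) = exch a c S := by
  ext x
  simp only [mem_exch]
  grind

theorem exch_exch_of_mem {a b c : ℕ} {S : Finset ℕ} (hab : a ≠ b) (hac : a ≠ c)
    (ha : a ∈ S) (hb : b ∈ S) : exch a b (exch b c S) = exch a c S := by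
  ext x
  simp only [mem_exch]
  grind

theorem wt_pos (α : ℕ → ℝ) (S : Finset ℕ) : 0 < wt α S := Real.exp_pos _

theorem wt_exch (α : ℕ → ℝ) {a b : ℕ} {S : Finset ℕ} (ha : a ∈ S) (hb : b ∉ S) :
    Real.exp (α a) * wt α (exch a b S) = Real.exp (α b) * wt α S := by
  have h : exch a b S = insert b (S.erase a) := by
    ext x
    simp only [mem_exch, Finset.mem_insert, Finset.mem_erase]
    grind
  have hb' : b ∉ S.erase a := fun h => hb (Finset.mem_of_mem_erase h)
  rw [wt, wt, h, Finset.sum_insert hb', ← Finset.add_sum_erase S α ha,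
    ← Real.exp_add, ← Real.exp_add]
  congr 1
  ring

/-- The family `F` of configurations is stable under exchanges of sites of `{1, …, L}`. -/
def ExchStable (L : ℕ) (F : Finset (Finset ℕ)) : Prop :=
  ∀ x ∈ Finset.Icc 1 L, ∀ y ∈ Finset.Icc 1 L, ∀ S ∈ F, exch x y S ∈ F

theorem exchStable_powerset (L : ℕ) : ExchStable L (Finset.Icc 1 L).powerset := by
  intro x hx y hy S hS
  rw [Finset.mem_powerset] at hS ⊢
  intro z hz
  rw [mem_exch] at hz
  split_ifs at hz with h1 h2
  · exact h1 ▸ hx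
  · exact h2 ▸ hy
  · exact hS hz

theorem exchStable_powersetCard (L N : ℕ) :
    ExchStable L ((Finset.Icc 1 L).powersetCard N) := by
  intro x hx y hy S hS
  rw [Finset.mem_powersetCard] at hS ⊢
  refine ⟨Finset.mem_powerset.1
    (exchStable_powerset L x hx y hy S (Finset.mem_powerset.2 hS.1)), ?_⟩
  rw [exch, Finset.card_image_of_injective _ (Equiv.injective _), hS.2]

/-- Dirichlet form of the exchange of `a` and `c`, each pair of configurations
`{ξ ∪ {a}, ξ ∪ {c}}` being counted once with weight `exp(α_a + α_c) wt(ξ)`. -/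
def edgeForm (F : Finset (Finset ℕ)) (α : ℕ → ℝ) (f : Finset ℕ → ℝ) (a c : ℕ) : ℝ :=
  ∑ S ∈ F with a ∈ S ∧ c ∉ S, Real.exp (α c) * wt α S * (grad a c f S) ^ 2

theorem sum_split (F : Finset (Finset ℕ)) (p : Finset ℕ → Prop) [DecidablePred p] (b : ℕ)
    (g : Finset ℕ → ℝ) :
    ∑ S ∈ F with p S, g S =
      (∑ S ∈ F with p S ∧ b ∉ S, g S) + ∑ S ∈ F with p S ∧ b ∈ S, g S := by
  rw [← Finset.sum_filter_add_sum_filter_not (F.filter p) (fun S => b ∉ S),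
    Finset.filter_filter, Finset.filter_filter]
  simp only [not_not]

/-- Change of variables `S ↦ exch a b S`. -/
theorem sum_exch {F : Finset (Finset ℕ)} {a b : ℕ} (hF : ∀ S ∈ F, exch a b S ∈ F)
    (p q : Finset ℕ → Prop) [DecidablePred p] [DecidablePred q]
    (hpq : ∀ S, p (exch a b S) ↔ q S) (g : Finset ℕ → ℝ) :
    ∑ S ∈ F with p S, g S = ∑ S ∈ F with q S, g (exch a b S) := by
  refine Finset.sum_nbij' (exch a b) (exch a b) ?_ ?_ ?_ ?_ ?_
  · intro S hS
    rw [Finset.mem_filter] at hS ⊢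
    exact ⟨hF S hS.1, by rw [← hpq, exch_exch]; exact hS.2⟩
  · intro S hS
    rw [Finset.mem_filter] at hS ⊢
    exact ⟨hF S hS.1, (hpq S).2 hS.2⟩
  · intro S _
    exact exch_exch a b S
  · intro S _
    exact exch_exch a b S
  · intro S _
    rw [exch_exch]

theorem add_sq_le_weighted {r s : ℝ} (hr : 0 < r) (hs : 0 < s) (u v : ℝ) :
    (u + v) ^ 2 ≤ (r + s) * (u ^ 2 / r + v ^ 2 / s) := by
  have h : (r + s) * (u ^ 2 / r + v ^ 2 / s) - (u + v) ^ 2 = (s * u - r * v) ^ 2 / (r * s) := by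
    field_simp
    ring
  have : 0 ≤ (s * u - r * v) ^ 2 / (r * s) := by positivity
  linarith

/-- Series law for an intermediate site `b` whose parameter dominates those of `a` and `c`. -/
theorem edgeForm_series {F : Finset (Finset ℕ)} (α : ℕ → ℝ) (f : Finset ℕ → ℝ) {a b c : ℕ}
    (hab : a ≠ b) (hac : a ≠ c) (hbc : b ≠ c)
    (hFab : ∀ S ∈ F, exch a b S ∈ F) (hFbc : ∀ S ∈ F, exch b c S ∈ F)
    (hα : α a ≤ α b) (hα' : α c ≤ α b) {r s : ℝ} (hr : 0 < r) (hs : 0 < s) :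
    edgeForm F α f a c ≤ (r + s) * (edgeForm F α f a b / r + edgeForm F α f b c / s) := by
  have e1 : ∑ S ∈ F with (b ∈ S ∧ c ∉ S) ∧ a ∉ S,
        Real.exp (α c) * wt α S * (grad b c f S) ^ 2 =
      ∑ S ∈ F with (a ∈ S ∧ c ∉ S) ∧ b ∉ S,
        Real.exp (α c) * wt α (exch a b S) * (grad b c f (exch a b S)) ^ 2 := by
    refine sum_exch hFab _ _ (fun S => ?_) _
    simp only [mem_exch]
    grind
  have e2 : ∑ S ∈ F with (a ∈ S ∧ b ∉ S) ∧ c ∈ S,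
        Real.exp (α b) * wt α S * (grad a b f S) ^ 2 =
      ∑ S ∈ F with (a ∈ S ∧ c ∉ S) ∧ b ∈ S,
        Real.exp (α b) * wt α (exch b c S) * (grad a b f (exch b c S)) ^ 2 := by
    refine sum_exch hFbc _ _ (fun S => ?_) _
    simp only [mem_exch]
    grind
  have h1 : ∀ S ∈ F.filter (fun S => (a ∈ S ∧ c ∉ S) ∧ b ∉ S),
      Real.exp (α c) * wt α S * (grad a c f S) ^ 2 ≤
        (r + s) * (Real.exp (α b) * wt α S * (grad a b f S) ^ 2 / r +
          Real.exp (α c) * wt α (exch a b S) * (grad b c f (exch a b S)) ^ 2 / s) := by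
    intro S hS
    obtain ⟨-, ⟨ha, hc⟩, hb⟩ := Finset.mem_filter.1 hS
    have hg : grad a c f S = grad a b f S + grad b c f (exch a b S) := by
      simp only [grad, exch_exch_of_notMem hac hbc hb hc]
      ring
    have hw := wt_exch α ha hb
    have hw0 := wt_pos α S
    have hw1 := wt_pos α (exch a b S)
    have hcb : Real.exp (α c) * wt α S ≤ Real.exp (α b) * wt α S :=
      mul_le_mul_of_nonneg_right (Real.exp_le_exp.2 hα') hw0.le
    have hle : wt α S ≤ wt α (exch a b S) := by
      have := mul_le_mul_of_nonneg_right (Real.exp_le_exp.2 hα) hw0.le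
      rw [← hw] at this
      exact le_of_mul_le_mul_left this (Real.exp_pos _)
    calc Real.exp (α c) * wt α S * (grad a c f S) ^ 2
        ≤ Real.exp (α c) * wt α S * ((r + s) *
            ((grad a b f S) ^ 2 / r + (grad b c f (exch a b S)) ^ 2 / s)) := by
          rw [hg]
          exact mul_le_mul_of_nonneg_left (add_sq_le_weighted hr hs _ _) (by positivity)
      _ = (r + s) * (Real.exp (α c) * wt α S * (grad a b f S) ^ 2 / r +
          Real.exp (α c) * wt α S * (grad b c f (exch a b S)) ^ 2 / s) := by ring
      _ ≤ _ := by gcongr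
  have h2 : ∀ S ∈ F.filter (fun S => (a ∈ S ∧ c ∉ S) ∧ b ∈ S),
      Real.exp (α c) * wt α S * (grad a c f S) ^ 2 ≤
        (r + s) * (Real.exp (α b) * wt α (exch b c S) * (grad a b f (exch b c S)) ^ 2 / r +
          Real.exp (α c) * wt α S * (grad b c f S) ^ 2 / s) := by
    intro S hS
    obtain ⟨-, ⟨ha, hc⟩, hb⟩ := Finset.mem_filter.1 hS
    have hg : grad a c f S = grad a b f (exch b c S) + grad b c f S := by
      simp only [grad, exch_exch_of_mem hab hac ha hb]
      ring
    have hw0 := wt_pos α S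
    rw [wt_exch α hb hc]
    calc Real.exp (α c) * wt α S * (grad a c f S) ^ 2
        ≤ Real.exp (α c) * wt α S * ((r + s) *
            ((grad a b f (exch b c S)) ^ 2 / r + (grad b c f S) ^ 2 / s)) := by
          rw [hg]
          exact mul_le_mul_of_nonneg_left (add_sq_le_weighted hr hs _ _) (by positivity)
      _ = _ := by ring
  have s1 := Finset.sum_le_sum h1
  have s2 := Finset.sum_le_sum h2
  rw [← Finset.mul_sum, Finset.sum_add_distrib, ← Finset.sum_div, ← Finset.sum_div] at s1 s2
  have c1 : ∀ g : Finset ℕ → ℝ, ∑ S ∈ F with (a ∈ S ∧ b ∉ S) ∧ c ∉ S, g S =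
      ∑ S ∈ F with (a ∈ S ∧ c ∉ S) ∧ b ∉ S, g S := fun g => by
    congr 1; ext S; simp only [Finset.mem_filter]; tauto
  have c2 : ∀ g : Finset ℕ → ℝ, ∑ S ∈ F with (b ∈ S ∧ c ∉ S) ∧ a ∈ S, g S =
      ∑ S ∈ F with (a ∈ S ∧ c ∉ S) ∧ b ∈ S, g S := fun g => by
    congr 1; ext S; simp only [Finset.mem_filter]; tauto
  rw [edgeForm, edgeForm, edgeForm, sum_split F _ b, sum_split F (fun S => a ∈ S ∧ b ∉ S) c,
    sum_split F (fun S => b ∈ S ∧ c ∉ S) a, e1, e2, c1, c2]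
  refine (add_le_add s1 s2).trans (le_of_eq ?_)
  ring

/-- Splitting recursively at the smallest interior parameter, the series law always applies. -/
theorem edgeForm_le_sum {L : ℕ} {F : Finset (Finset ℕ)} (hF : ExchStable L F) (α : ℕ → ℝ)
    (f : Finset ℕ → ℝ) (n : ℕ) : ∀ a c : ℕ, c = a + n → 1 ≤ a → a < c → c ≤ L →
    (∀ b ∈ Finset.Ioo a c, α a ≤ α b ∧ α c ≤ α b) →
    edgeForm F α f a c ≤ n * ∑ x ∈ Finset.Ico a c, edgeForm F α f x (x + 1) := by
  induction n using Nat.strong_induction_on with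
  | _ n ih =>
    intro a c hc ha hac hcL hα
    rcases (Finset.Ioo a c).eq_empty_or_nonempty with he | hne
    · have hn : n = 1 := by
        by_contra hn
        have : a + 1 ∈ Finset.Ioo a c := Finset.mem_Ioo.2 ⟨by lia, by lia⟩
        rw [he] at this
        exact absurd this (Finset.notMem_empty _)
      subst hn hc
      simp
    · obtain ⟨b, hb, hmin⟩ := Finset.exists_min_image _ α hne
      obtain ⟨hab, hbc⟩ := Finset.mem_Ioo.1 hb
      obtain ⟨h1, h2⟩ := hα b hb
      obtain ⟨k, rfl⟩ : ∃ k, b = a + k := ⟨b - a, by lia⟩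
      obtain ⟨l, rfl⟩ : ∃ l, n = k + l := ⟨n - k, by lia⟩
      have hk : (0 : ℝ) < k := by exact_mod_cast (by lia : 0 < k)
      have hl : (0 : ℝ) < l := by exact_mod_cast (by lia : 0 < l)
      have i1 := ih k (by lia) a (a + k) rfl ha hab (by lia) (fun x hx => by
        rw [Finset.mem_Ioo] at hx
        have hx' : x ∈ Finset.Ioo a c := Finset.mem_Ioo.2 ⟨hx.1, by lia⟩
        exact ⟨(hα x hx').1, hmin x hx'⟩)
      have i2 := ih l (by lia) (a + k) c (by lia) (by lia) hbc hcL (fun x hx => by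
        rw [Finset.mem_Ioo] at hx
        have hx' : x ∈ Finset.Ioo a c := Finset.mem_Ioo.2 ⟨by lia, hx.2⟩
        exact ⟨hmin x hx', (hα x hx').2⟩)
      have mem : ∀ x, 1 ≤ x → x ≤ L → x ∈ Finset.Icc 1 L := fun x h h' =>
        Finset.mem_Icc.2 ⟨h, h'⟩
      refine (edgeForm_series α f hab.ne hac.ne hbc.ne
        (hF _ (mem _ ha (by lia)) _ (mem _ (by lia) (by lia)))
        (hF _ (mem _ (by lia) (by lia)) _ (mem _ (by lia) hcL)) h1 h2 hk hl).trans ?_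
      rw [← Finset.sum_Ico_consecutive _ hab.le hbc.le]
      push_cast
      refine mul_le_mul_of_nonneg_left (add_le_add ?_ ?_) (by positivity)
      · rw [div_le_iff₀ hk]
        linarith
      · rw [div_le_iff₀ hl]
        linarith

theorem sum_grad_sq {F : Finset (Finset ℕ)} (α : ℕ → ℝ) (f : Finset ℕ → ℝ) {a c : ℕ}
    (hF : ∀ S ∈ F, exch a c S ∈ F) :
    ∑ S ∈ F, wt α S * (grad a c f S) ^ 2 =
      (Real.exp (-α a) + Real.exp (-α c)) * edgeForm F α f a c := by
  have hsplit : ∑ S ∈ F, wt α S * (grad a c f S) ^ 2 =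
      (∑ S ∈ F with a ∈ S ∧ c ∉ S, wt α S * (grad a c f S) ^ 2) +
        ∑ S ∈ F with c ∈ S ∧ a ∉ S, wt α S * (grad a c f S) ^ 2 := by
    rw [Finset.sum_filter, Finset.sum_filter, ← Finset.sum_add_distrib]
    refine Finset.sum_congr rfl fun S _ => ?_
    by_cases h : a ∈ S <;> by_cases h' : c ∈ S <;>
      simp [h, h', grad, exch_eq_self (S := S) (a := a) (b := c)]
  have e : ∑ S ∈ F with c ∈ S ∧ a ∉ S, wt α S * (grad a c f S) ^ 2 =
      ∑ S ∈ F with a ∈ S ∧ c ∉ S, wt α (exch a c S) * (grad a c f (exch a c S)) ^ 2 := by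
    refine sum_exch hF _ _ (fun S => ?_) _
    simp only [mem_exch]
    grind
  rw [hsplit, e, ← Finset.sum_add_distrib, edgeForm, Finset.mul_sum]
  refine Finset.sum_congr rfl fun S hS => ?_
  obtain ⟨-, ha, hc⟩ := Finset.mem_filter.1 hS
  have hw : wt α (exch a c S) = Real.exp (-α a) * (Real.exp (α c) * wt α S) := by
    rw [← wt_exch α ha hc, ← mul_assoc, ← Real.exp_add]
    simp
  have hc1 : Real.exp (-α c) * Real.exp (α c) = 1 := by
    rw [← Real.exp_add]
    simp
  rw [hw]
  simp only [grad, exch_exch]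
  linear_combination (-(wt α S * (f (exch a c S) - f S) ^ 2)) * hc1

theorem edgeForm_nonneg (F : Finset (Finset ℕ)) (α : ℕ → ℝ) (f : Finset ℕ → ℝ) (a c : ℕ) :
    0 ≤ edgeForm F α f a c :=
  Finset.sum_nonneg fun S _ => mul_nonneg (mul_nonneg (Real.exp_pos _).le (wt_pos α S).le)
    (sq_nonneg _)

/-- The moving particle inequality when the end sites carry the minimal parameter `-B`. -/
theorem sum_grad_sq_le_of_ends {B : ℝ} {L : ℕ} (hL : 2 ≤ L) {α : ℕ → ℝ}
    (hα : ∀ x ∈ Finset.Icc 1 L, |α x| ≤ B) (h1 : α 1 = -B) (h2 : α L = -B)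
    {F : Finset (Finset ℕ)} (hF : ExchStable L F) (f : Finset ℕ → ℝ) :
    ∑ S ∈ F, wt α S * (grad 1 L f S) ^ 2 ≤
      Real.exp (2 * B) * L *
        ∑ x ∈ Finset.Icc 1 (L - 1), ∑ S ∈ F, wt α S * (grad x (x + 1) f S) ^ 2 := by
  have hB : ∀ x ∈ Finset.Icc 1 L, Real.exp (-B) ≤ Real.exp (-α x) := fun x hx =>
    Real.exp_le_exp.2 (neg_le_neg (abs_le.1 (hα x hx)).2)
  have hpath := edgeForm_le_sum hF α f (L - 1) 1 L (by lia) le_rfl (by lia) le_rfl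
    (fun b hb => by
      rw [Finset.mem_Ioo] at hb
      have := (abs_le.1 (hα b (Finset.mem_Icc.2 ⟨by lia, by lia⟩))).1
      exact ⟨by rw [h1]; exact this, by rw [h2]; exact this⟩)
  have hI : Finset.Ico 1 L = Finset.Icc 1 (L - 1) := by
    ext x
    simp only [Finset.mem_Ico, Finset.mem_Icc]
    lia
  rw [hI] at hpath
  have hbond : ∀ x ∈ Finset.Icc 1 (L - 1), 2 * Real.exp (-B) * edgeForm F α f x (x + 1) ≤
      ∑ S ∈ F, wt α S * (grad x (x + 1) f S) ^ 2 := by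
    intro x hx
    rw [Finset.mem_Icc] at hx
    have m1 : x ∈ Finset.Icc 1 L := Finset.mem_Icc.2 ⟨by lia, by lia⟩
    have m2 : x + 1 ∈ Finset.Icc 1 L := Finset.mem_Icc.2 ⟨by lia, by lia⟩
    rw [sum_grad_sq α f (hF x m1 (x + 1) m2)]
    refine mul_le_mul_of_nonneg_right ?_ (edgeForm_nonneg _ _ _ _ _)
    linarith [hB x m1, hB (x + 1) m2]
  have hsum := Finset.sum_le_sum hbond
  rw [← Finset.mul_sum] at hsum
  have hcast : ((L - 1 : ℕ) : ℝ) ≤ L := by exact_mod_cast Nat.sub_le L 1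
  have hnn : 0 ≤ ∑ x ∈ Finset.Icc 1 (L - 1), edgeForm F α f x (x + 1) :=
    Finset.sum_nonneg fun x _ => edgeForm_nonneg _ _ _ _ _
  have hexp : Real.exp (2 * B) * Real.exp (-B) = Real.exp B := by
    rw [← Real.exp_add]
    ring_nf
  rw [sum_grad_sq α f (hF 1 (Finset.mem_Icc.2 ⟨le_rfl, by lia⟩) L
    (Finset.mem_Icc.2 ⟨by lia, le_rfl⟩)), h1, h2, neg_neg]
  calc (Real.exp B + Real.exp B) * edgeForm F α f 1 L
      ≤ (Real.exp B + Real.exp B) *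
        (L * ∑ x ∈ Finset.Icc 1 (L - 1), edgeForm F α f x (x + 1)) :=
        mul_le_mul_of_nonneg_left
          (hpath.trans (mul_le_mul_of_nonneg_right hcast hnn)) (by positivity)
    _ = Real.exp (2 * B) * L *
        (2 * Real.exp (-B) * ∑ x ∈ Finset.Icc 1 (L - 1), edgeForm F α f x (x + 1)) := by
        rw [← hexp]
        ring
    _ ≤ _ := mul_le_mul_of_nonneg_left hsum (by positivity)

/-- The parameters `α` with the values at the sites `1` and `L` lowered to `-B`. -/
def lowerEnds (B : ℝ) (L : ℕ) (α : ℕ → ℝ) (x : ℕ) : ℝ := if x = 1 ∨ x = L then -B else α x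

theorem wt_lowerEnds_le {B : ℝ} {L : ℕ} {α : ℕ → ℝ}
    (hα : ∀ x ∈ Finset.Icc 1 L, |α x| ≤ B) {S : Finset ℕ} (hS : S ⊆ Finset.Icc 1 L) :
    wt (lowerEnds B L α) S ≤ wt α S := by
  refine Real.exp_le_exp.2 (Finset.sum_le_sum fun x hx => ?_)
  unfold lowerEnds
  split_ifs
  · exact (abs_le.1 (hα x (hS hx))).1
  · exact le_rfl

theorem wt_le_wt_lowerEnds {B : ℝ} (hB : 0 ≤ B) {L : ℕ} {α : ℕ → ℝ}
    (hα : ∀ x ∈ Finset.Icc 1 L, |α x| ≤ B) {S : Finset ℕ} (hS : S ⊆ Finset.Icc 1 L) :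
    wt α S ≤ Real.exp (4 * B) * wt (lowerEnds B L α) S := by
  rw [wt, wt, ← Real.exp_add]
  refine Real.exp_le_exp.2 ?_
  have h : ∑ x ∈ S, α x ≤
      ∑ x ∈ S, ((if x ∈ ({1, L} : Finset ℕ) then 2 * B else 0) + lowerEnds B L α x) := by
    refine Finset.sum_le_sum fun x hx => ?_
    have := (abs_le.1 (hα x (hS hx))).2
    simp only [lowerEnds, Finset.mem_insert, Finset.mem_singleton]
    split_ifs <;> linarith
  rw [Finset.sum_add_distrib, ← Finset.sum_filter, Finset.sum_const, nsmul_eq_mul] at h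
  have hcard : ((S.filter (· ∈ ({1, L} : Finset ℕ))).card : ℝ) ≤ 2 := by
    have : S.filter (· ∈ ({1, L} : Finset ℕ)) ⊆ {1, L} := fun x hx =>
      (Finset.mem_filter.1 hx).2
    exact_mod_cast (Finset.card_le_card this).trans Finset.card_le_two
  nlinarith

theorem sum_grad_sq_le {B : ℝ} (hB : 0 ≤ B) {L : ℕ} (hL : 2 ≤ L) {α : ℕ → ℝ}
    (hα : ∀ x ∈ Finset.Icc 1 L, |α x| ≤ B) {F : Finset (Finset ℕ)} (hF : ExchStable L F)
    (hsub : ∀ S ∈ F, S ⊆ Finset.Icc 1 L) (f : Finset ℕ → ℝ) :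
    ∑ S ∈ F, wt α S * (grad 1 L f S) ^ 2 ≤
      Real.exp (13 * B) * L *
        ∑ x ∈ Finset.Icc 1 (L - 1), ∑ S ∈ F, wt α S * (grad x (x + 1) f S) ^ 2 := by
  have hα' : ∀ x ∈ Finset.Icc 1 L, |lowerEnds B L α x| ≤ B := by
    intro x hx
    unfold lowerEnds
    split_ifs
    · rw [abs_neg, abs_of_nonneg hB]
    · exact hα x hx
  have key := sum_grad_sq_le_of_ends hL hα' (by simp [lowerEnds]) (by simp [lowerEnds]) hF f
  have hnn : 0 ≤ ∑ x ∈ Finset.Icc 1 (L - 1), ∑ S ∈ F, wt α S * (grad x (x + 1) f S) ^ 2 :=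
    Finset.sum_nonneg fun x _ => Finset.sum_nonneg fun S _ =>
      mul_nonneg (wt_pos α S).le (sq_nonneg _)
  calc ∑ S ∈ F, wt α S * (grad 1 L f S) ^ 2
      ≤ Real.exp (4 * B) * ∑ S ∈ F, wt (lowerEnds B L α) S * (grad 1 L f S) ^ 2 := by
        rw [Finset.mul_sum]
        refine Finset.sum_le_sum fun S hS => ?_
        rw [← mul_assoc]
        exact mul_le_mul_of_nonneg_right (wt_le_wt_lowerEnds hB hα (hsub S hS)) (sq_nonneg _)
    _ ≤ Real.exp (4 * B) * (Real.exp (2 * B) * L * ∑ x ∈ Finset.Icc 1 (L - 1),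
          ∑ S ∈ F, wt α S * (grad x (x + 1) f S) ^ 2) := by
        refine mul_le_mul_of_nonneg_left (key.trans ?_) (Real.exp_pos _).le
        refine mul_le_mul_of_nonneg_left ?_ (by positivity)
        exact Finset.sum_le_sum fun x _ => Finset.sum_le_sum fun S hS =>
          mul_le_mul_of_nonneg_right (wt_lowerEnds_le hα (hsub S hS)) (sq_nonneg _)
    _ = Real.exp (6 * B) * L * ∑ x ∈ Finset.Icc 1 (L - 1),
          ∑ S ∈ F, wt α S * (grad x (x + 1) f S) ^ 2 := by
        rw [show (6 : ℝ) * B = 4 * B + 2 * B by ring, Real.exp_add]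
        ring
    _ ≤ _ := by
        have : Real.exp (6 * B) ≤ Real.exp (13 * B) := Real.exp_le_exp.2 (by linarith)
        gcongr

theorem stmt_3 (B : ℝ) (hB : 0 ≤ B) (L : ℕ) (hL : 2 ≤ L) (α : ℕ → ℝ)
    (hα : ∀ x ∈ Finset.Icc 1 L, |α x| ≤ B) (f : Finset ℕ → ℝ) :
    (prodE L α (fun S => (grad 1 L f S) ^ 2) ≤
      Real.exp (13 * B) * L *
        ∑ x ∈ Finset.Icc 1 (L - 1), prodE L α (fun S => (grad x (x + 1) f S) ^ 2)) ∧
    ∀ N ≤ L, canonE L N α (fun S => (grad 1 L f S) ^ 2) ≤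
      Real.exp (13 * B) * L *
        ∑ x ∈ Finset.Icc 1 (L - 1), canonE L N α (fun S => (grad x (x + 1) f S) ^ 2) := by
  have hdiv : ∀ F : Finset (Finset ℕ), 0 ≤ ∑ S ∈ F, wt α S := fun F =>
    Finset.sum_nonneg fun S _ => (wt_pos α S).le
  constructor
  · simp only [prodE]
    rw [← Finset.sum_div, ← mul_div_assoc]
    exact div_le_div_of_nonneg_right (sum_grad_sq_le hB hL hα (exchStable_powerset L)
      (fun S hS => Finset.mem_powerset.1 hS) f) (hdiv _)
  · intro N _
    simp only [canonE]
    rw [← Finset.sum_div, ← mul_div_assoc]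
    exact div_le_div_of_nonneg_right (sum_grad_sq_le hB hL hα (exchStable_powersetCard L N)
      (fun S hS => (Finset.mem_powersetCard.1 hS).1) f) (hdiv _)
end
end

section
/- (Spectral gap of the Bernoulli–Laplace model with site disorder.) For every B ≥ 0 there exists a constant C = C(B) < ∞ such that for every finite set Λ ⊂ ℤ^d, every field α : Λ → [−B, B], every integer 0 ≤ N ≤ |Λ|, and every function f : {0,1}^Λ → ℝ, Var_{Λ,N}(f) ≤ C |Λ|^{-1} E_{Λ,N}[ Σ_{x,y∈Λ} (∇_{xy} f)² ], where Var_{Λ,N} and E_{Λ,N} denote the variance and expectation with respect to the canonical measure. -/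
noncomputable section

/-- `T_{xy}η`: the configuration (given by its set of occupied sites) with the occupation
numbers at `x` and `y` exchanged. -/
def exchV {V : Type*} [DecidableEq V] (x y : V) (S : Finset V) : Finset V :=
  S.image (Equiv.swap x y)

/-- `∇_{xy} f (η) = f(T_{xy}η) - f(η)`. -/
def gradV {V : Type*} [DecidableEq V] (x y : V) (f : Finset V → ℝ) (S : Finset V) : ℝ :=
  f (exchV x y S) - f S

/-- Expectation with respect to the canonical measure on `{0,1}^Λ` with field `α` and `N`
particles: a configuration `S ⊆ Λ` with `|S| = N` has weight proportional to
`exp(∑_{x ∈ S} α_x)`. -/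
def cE {V : Type*} [DecidableEq V] (Λ : Finset V) (α : V → ℝ) (N : ℕ)
    (g : Finset V → ℝ) : ℝ :=
  (∑ S ∈ Λ.powersetCard N, Real.exp (∑ x ∈ S, α x) * g S) /
    ∑ S ∈ Λ.powersetCard N, Real.exp (∑ x ∈ S, α x)

/-- Variance with respect to the canonical measure. -/
def cVar {V : Type*} [DecidableEq V] (Λ : Finset V) (α : V → ℝ) (N : ℕ)
    (f : Finset V → ℝ) : ℝ :=
  cE Λ α N fun S => (f S - cE Λ α N f) ^ 2

section SpectralGap

open Finset

/-- A symmetric nonnegative operator with `L ≤ L²` has no spectrum in `(0, 1)`. -/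
theorem exists_ker_form_sub_le {E : Type*} [AddCommGroup E] [Module ℝ E] [FiniteDimensional ℝ E]
    (b : E →ₗ[ℝ] E →ₗ[ℝ] ℝ) (L : E →ₗ[ℝ] E)
    (hdef : ∀ x, b x x = 0 → x = 0) (hsymm : ∀ x y, b x (L y) = b (L x) y)
    (hnonneg : ∀ x, 0 ≤ b x (L x)) (hsq : ∀ x, b x (L x) ≤ b (L x) (L x)) (f : E) :
    ∃ k, L k = 0 ∧ b (f - k) (f - k) ≤ b f (L f) := by
  have hdisj : Disjoint (LinearMap.ker L) (LinearMap.range L) := by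
    rw [Submodule.disjoint_def]
    rintro _ hx ⟨g, rfl⟩
    apply hdef
    rw [← hsymm, LinearMap.mem_ker.1 hx, map_zero]
  have htop : LinearMap.ker L ⊔ LinearMap.range L = ⊤ := by
    apply Submodule.eq_top_of_disjoint _ _ _ hdisj
    rw [add_comm]
    exact (LinearMap.finrank_range_add_finrank_ker L).ge
  obtain ⟨k, hk, _, ⟨g, rfl⟩, rfl⟩ := Submodule.mem_sup.1 (htop ▸ Submodule.mem_top (x := f))
  rw [LinearMap.mem_ker] at hk
  refine ⟨k, hk, ?_⟩
  have h₁ := hnonneg (L g - g)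
  have h₂ := hsq g
  have h₃ := hsymm (L g) g
  have h₄ := hsymm g (L g)
  have h₅ := hsymm k (L g)
  simp only [map_sub, map_add, LinearMap.sub_apply, LinearMap.add_apply, hk, map_zero,
    LinearMap.zero_apply, add_sub_cancel_left, zero_add] at *
  linarith

variable {V : Type*}

/-- The subsets of `Λ` with `k` elements fewer than `N`. -/
def subsetsBelow (Λ : Finset V) (N k : ℕ) : Finset (Finset V) :=
  {S ∈ Λ.powerset | S.card + k = N}

theorem mem_subsetsBelow {Λ S : Finset V} {N k : ℕ} :
    S ∈ subsetsBelow Λ N k ↔ S ⊆ Λ ∧ S.card + k = N := by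
  simp [subsetsBelow]

theorem subsetsBelow_zero (Λ : Finset V) (N : ℕ) : subsetsBelow Λ N 0 = Λ.powersetCard N := by
  ext S
  rw [mem_subsetsBelow, mem_powersetCard, add_zero]

theorem partition_pos {Λ : Finset V} (α : V → ℝ) {N : ℕ} (hN : N ≤ Λ.card) :
    0 < ∑ S ∈ Λ.powersetCard N, Real.exp (∑ x ∈ S, α x) :=
  sum_pos (fun _ _ => Real.exp_pos _) (powersetCard_nonempty.2 hN)

variable [DecidableEq V]

theorem sum_sum_erase_swap (A : Finset V) (F : V → V → ℝ) :
    ∑ q ∈ A, ∑ p ∈ A.erase q, F p q = ∑ q ∈ A, ∑ p ∈ A.erase q, F q p := by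
  apply Finset.sum_comm'
  intro x y
  simp only [mem_erase]
  tauto

/-- Nonnegativity of the mixed term for two particles. -/
theorem two_particle_nonneg (A : Finset V) (w : V → ℝ) (hw : ∀ x, 0 < w x) (F : V → V → ℝ)
    (hF : ∀ p q, F p q = F q p) (G : V → ℝ)
    (hG : ∀ q ∈ A, ∑ p ∈ A.erase q, w p * (F p q - G q) = 0) :
    0 ≤ ∑ q ∈ A, ∑ p ∈ A.erase q, w p * w q * ((F p q - G q) * (F p q - G p)) := by
  rcases A.eq_empty_or_nonempty with rfl | hA
  · simp
  have hW : 0 < ∑ q ∈ A, w q := sum_pos (fun x _ => hw x) hA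
  set c := (∑ q ∈ A, w q * G q) / ∑ q ∈ A, w q with hc
  have hc0 : ∑ q ∈ A, w q * (G q - c) = 0 := by
    simp only [mul_sub, sum_sub_distrib, ← sum_mul]
    rw [hc]
    field_simp
    ring
  have h₁ : ∑ q ∈ A, ∑ p ∈ A.erase q, w p * w q * ((G q - c) * (F p q - G q)) = 0 := by
    apply sum_eq_zero
    intro q hq
    have := congrArg (fun t => w q * (G q - c) * t) (hG q hq)
    simp only [mul_sum, mul_zero] at this
    rw [← this]
    exact sum_congr rfl fun p _ => by ring
  have h₂ : ∑ q ∈ A, ∑ p ∈ A.erase q, w p * w q * ((G p - c) * (F p q - G p)) = 0 := by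
    rw [sum_sum_erase_swap A fun p q => w p * w q * ((G p - c) * (F p q - G p)), ← h₁]
    exact sum_congr rfl fun q _ => sum_congr rfl fun p _ => by rw [hF q p]; ring
  have h₃ : ∑ q ∈ A, ∑ p ∈ A.erase q, w p * w q * ((G q - c) * (G p - c)) ≤ 0 := by
    have : ∀ q ∈ A, ∑ p ∈ A.erase q, w p * w q * ((G q - c) * (G p - c))
        = - (w q * (G q - c)) ^ 2 := by
      intro q hq
      have h := add_sum_erase A (fun p => w p * (G p - c)) hq
      rw [hc0] at h
      have h' : ∑ p ∈ A.erase q, w p * (G p - c) = - (w q * (G q - c)) := by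
        linarith
      rw [sq, ← mul_neg, ← h', mul_sum]
      exact sum_congr rfl fun p _ => by ring
    rw [sum_congr rfl this]
    exact sum_nonpos fun q _ => neg_nonpos.2 (sq_nonneg _)
  have h₄ : 0 ≤ ∑ q ∈ A, ∑ p ∈ A.erase q, w p * w q * (F p q - G q - G p + c) ^ 2 :=
    sum_nonneg fun q _ => sum_nonneg fun p _ =>
      mul_nonneg (mul_pos (hw p) (hw q)).le (sq_nonneg _)
  have key : ∑ q ∈ A, ∑ p ∈ A.erase q, w p * w q * ((F p q - G q) * (F p q - G p))
      = ∑ q ∈ A, ∑ p ∈ A.erase q, w p * w q * (F p q - G q - G p + c) ^ 2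
        + ∑ q ∈ A, ∑ p ∈ A.erase q, w p * w q * ((G q - c) * (F p q - G q))
        + ∑ q ∈ A, ∑ p ∈ A.erase q, w p * w q * ((G p - c) * (F p q - G p))
        - ∑ q ∈ A, ∑ p ∈ A.erase q, w p * w q * ((G q - c) * (G p - c)) := by
    simp only [← sum_add_distrib, ← sum_sub_distrib]
    exact sum_congr rfl fun q _ => sum_congr rfl fun p _ => by ring
  rw [key, h₁, h₂]
  linarith

theorem sum_subsetsBelow_succ (Λ : Finset V) (N k : ℕ) (ψ : Finset V → V → ℝ) :
    ∑ S ∈ subsetsBelow Λ N k, ∑ x ∈ S, ψ S x =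
      ∑ T ∈ subsetsBelow Λ N (k + 1), ∑ y ∈ Λ \ T, ψ (insert y T) y := by
  rw [sum_sigma', sum_sigma']
  refine sum_bij' (fun a _ => ⟨a.1.erase a.2, a.2⟩) (fun a _ => ⟨insert a.2 a.1, a.2⟩)
    ?_ ?_ ?_ ?_ ?_
  · rintro ⟨S, x⟩ h
    simp only [mem_sigma, mem_subsetsBelow, mem_sdiff] at h ⊢
    have := card_erase_add_one h.2
    exact ⟨⟨(erase_subset _ _).trans h.1.1, by omega⟩, h.1.1 h.2, notMem_erase _ _⟩
  · rintro ⟨T, y⟩ h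
    simp only [mem_sigma, mem_subsetsBelow, mem_sdiff] at h ⊢
    have := card_insert_of_notMem h.2.2
    exact ⟨⟨insert_subset h.2.1 h.1.1, by omega⟩, mem_insert_self _ _⟩
  · rintro ⟨S, x⟩ h
    simp only [mem_sigma] at h
    simp [insert_erase h.2]
  · rintro ⟨T, y⟩ h
    simp only [mem_sigma, mem_sdiff] at h
    simp [erase_insert h.2.2]
  · rintro ⟨S, x⟩ h
    simp only [mem_sigma] at h
    simp [insert_erase h.2]

/-- Conditional mean of `f` given all particles but one, sitting at `T`. -/
def condMean (Λ : Finset V) (w : V → ℝ) (f : Finset V → ℝ) (T : Finset V) : ℝ :=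
  (∑ y ∈ Λ \ T, w y * f (insert y T)) / ∑ y ∈ Λ \ T, w y

/-- Deviation of `f` from its conditional mean when the particle at `x` is resampled. -/
def resampleDev (Λ : Finset V) (w : V → ℝ) (f : Finset V → ℝ) (S : Finset V) (x : V) : ℝ :=
  f S - condMean Λ w f (S.erase x)

/-- The generator (with positive sign) of the dynamics resampling each particle at rate one. -/
def resampleGen (Λ : Finset V) (w : V → ℝ) :
    (Finset V → ℝ) →ₗ[ℝ] (Finset V → ℝ) where
  toFun f S := ∑ x ∈ S, resampleDev Λ w f S x
  map_add' f g := by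
    ext S
    simp only [Pi.add_apply, ← sum_add_distrib]
    refine sum_congr rfl fun x _ => ?_
    simp only [resampleDev, condMean, Pi.add_apply, mul_add, sum_add_distrib, add_div]
    ring
  map_smul' c f := by
    ext S
    simp only [Pi.smul_apply, smul_eq_mul, RingHom.id_apply, mul_sum]
    refine sum_congr rfl fun x _ => ?_
    simp only [resampleDev, condMean, Pi.smul_apply, smul_eq_mul, mul_left_comm _ c, ← mul_sum]
    ring

theorem resampleGen_apply (Λ : Finset V) (w : V → ℝ) (f : Finset V → ℝ) (S : Finset V) :
    resampleGen Λ w f S = ∑ x ∈ S, resampleDev Λ w f S x := rfl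

theorem sum_mul_sub_condMean (Λ : Finset V) (w : V → ℝ) (hw : ∀ x, 0 < w x)
    (f : Finset V → ℝ) (T : Finset V) :
    ∑ y ∈ Λ \ T, w y * (f (insert y T) - condMean Λ w f T) = 0 := by
  rcases (Λ \ T).eq_empty_or_nonempty with h | h
  · simp [h]
  have hW : 0 < ∑ q ∈ Λ \ T, w q := sum_pos (fun x _ => hw x) h
  simp only [mul_sub, sum_sub_distrib, ← sum_mul]
  rw [condMean]
  field_simp
  ring

theorem sum_prod_mul_condMean_mul_resampleDev (Λ : Finset V) (w : V → ℝ) (hw : ∀ x, 0 < w x)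
    (N k : ℕ) (f g : Finset V → ℝ) :
    ∑ S ∈ subsetsBelow Λ N k, ∑ x ∈ S,
      (∏ z ∈ S, w z) * (condMean Λ w g (S.erase x) * resampleDev Λ w f S x) = 0 := by
  rw [sum_subsetsBelow_succ Λ N k fun S x =>
    (∏ z ∈ S, w z) * (condMean Λ w g (S.erase x) * resampleDev Λ w f S x)]
  refine sum_eq_zero fun T _ => ?_
  have h := congrArg (fun t => (∏ z ∈ T, w z) * condMean Λ w g T * t)
    (sum_mul_sub_condMean Λ w hw f T)
  simp only [mul_sum, mul_zero] at h
  rw [← h]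
  refine sum_congr rfl fun y hy => ?_
  have hy' := (mem_sdiff.1 hy).2
  rw [prod_insert hy', resampleDev, erase_insert hy']
  ring

theorem sum_prod_mul_resampleGen (Λ : Finset V) (w : V → ℝ) (hw : ∀ x, 0 < w x)
    (N k : ℕ) (f g : Finset V → ℝ) :
    ∑ S ∈ subsetsBelow Λ N k, (∏ z ∈ S, w z) * (g S * resampleGen Λ w f S) =
      ∑ S ∈ subsetsBelow Λ N k, (∏ z ∈ S, w z) *
        ∑ x ∈ S, resampleDev Λ w g S x * resampleDev Λ w f S x := by
  rw [← sub_eq_zero, ← sum_prod_mul_condMean_mul_resampleDev Λ w hw N k f g, ← sum_sub_distrib]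
  refine sum_congr rfl fun S _ => ?_
  rw [resampleGen_apply, mul_sum, mul_sum, mul_sum, ← sum_sub_distrib]
  refine sum_congr rfl fun x _ => ?_
  rw [resampleDev.eq_1 Λ w g]
  ring

theorem sum_prod_mul_cross_nonneg (Λ : Finset V) (w : V → ℝ) (hw : ∀ x, 0 < w x)
    (N k : ℕ) (f : Finset V → ℝ) :
    0 ≤ ∑ S ∈ subsetsBelow Λ N k, ∑ x ∈ S, ∑ y ∈ S.erase x,
      (∏ z ∈ S, w z) * (resampleDev Λ w f S x * resampleDev Λ w f S y) := by
  rw [sum_subsetsBelow_succ Λ N k fun S x => ∑ y ∈ S.erase x,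
    (∏ z ∈ S, w z) * (resampleDev Λ w f S x * resampleDev Λ w f S y)]
  have h : ∀ T ∈ subsetsBelow Λ N (k + 1), ∑ y ∈ Λ \ T, ∑ z ∈ (insert y T).erase y,
      (∏ z ∈ insert y T, w z) *
        (resampleDev Λ w f (insert y T) y * resampleDev Λ w f (insert y T) z) =
      ∑ z ∈ T, ∑ y ∈ Λ \ T, (∏ z ∈ insert y T, w z) *
        (resampleDev Λ w f (insert y T) y * resampleDev Λ w f (insert y T) z) := by
    intro T _
    rw [sum_comm]
    refine sum_congr rfl fun y hy => ?_
    rw [erase_insert (mem_sdiff.1 hy).2]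
  rw [sum_congr rfl h, sum_subsetsBelow_succ Λ N (k + 1) fun T z => ∑ y ∈ Λ \ T,
    (∏ z ∈ insert y T, w z) *
        (resampleDev Λ w f (insert y T) y * resampleDev Λ w f (insert y T) z)]
  refine sum_nonneg fun R _ => ?_
  have hloc := two_particle_nonneg (Λ \ R) w hw (fun p q => f (insert p (insert q R)))
    (fun p q => by rw [insert_comm]) (fun q => condMean Λ w f (insert q R))
    (fun q _ => by rw [← sdiff_insert]; exact sum_mul_sub_condMean Λ w hw f (insert q R))
  have hR : 0 ≤ ∏ z ∈ R, w z := prod_nonneg fun z _ => (hw z).le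
  have := mul_nonneg hR hloc
  rw [mul_sum] at this
  refine this.trans_eq (sum_congr rfl fun q hq => ?_)
  rw [sdiff_insert, mul_sum]
  refine sum_congr rfl fun p hp => ?_
  have hq' := (mem_sdiff.1 hq).2
  obtain ⟨hpq, hp'⟩ := mem_erase.1 hp
  have hp'' : p ∉ insert q R := by simp [hpq, (mem_sdiff.1 hp').2]
  have hq'' : q ∉ insert p R := by simp [hpq.symm, hq']
  rw [prod_insert hp'', prod_insert hq', resampleDev, resampleDev, erase_insert hp'',
    insert_comm p q R, erase_insert hq'']
  ring

theorem sum_prod_mul_resampleDev_sq_le (Λ : Finset V) (w : V → ℝ) (hw : ∀ x, 0 < w x)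
    (N k : ℕ) (f : Finset V → ℝ) :
    ∑ S ∈ subsetsBelow Λ N k, (∏ z ∈ S, w z) *
        ∑ x ∈ S, resampleDev Λ w f S x * resampleDev Λ w f S x ≤
      ∑ S ∈ subsetsBelow Λ N k, (∏ z ∈ S, w z) *
        (resampleGen Λ w f S * resampleGen Λ w f S) := by
  rw [← sub_nonneg, ← sum_sub_distrib]
  refine (sum_prod_mul_cross_nonneg Λ w hw N k f).trans_eq (sum_congr rfl fun S _ => ?_)
  rw [resampleGen_apply, sum_mul_sum, ← mul_sub, ← sum_sub_distrib, mul_sum]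
  refine sum_congr rfl fun x hx => ?_
  rw [← mul_sum, ← add_sum_erase S _ hx, add_sub_cancel_left]

theorem eq_of_forall_exchange (Λ : Finset V) (N : ℕ) (f : Finset V → ℝ)
    (hf : ∀ S ⊆ Λ, S.card = N → ∀ x ∈ S, ∀ y ∈ Λ \ S, f (insert y (S.erase x)) = f S)
    (S S' : Finset V) (hS : S ⊆ Λ) (hSN : S.card = N) (hS' : S' ⊆ Λ) (hSN' : S'.card = N) :
    f S = f S' := by
  induction h : (S \ S').card generalizing S with
  | zero =>
    rw [eq_of_subset_of_card_le (sdiff_eq_empty_iff_subset.1 (card_eq_zero.1 h))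
      (by omega)]
  | succ m ih =>
    obtain ⟨x, hx⟩ := card_pos.1 (by omega : 0 < (S \ S').card)
    have hcard := card_sdiff_add_card_inter S S'
    have hcard' := card_sdiff_add_card_inter S' S
    rw [inter_comm] at hcard'
    obtain ⟨y, hy⟩ := card_pos.1 (by omega : 0 < (S' \ S).card)
    rw [mem_sdiff] at hx hy
    have hy' : y ∉ S.erase x := fun h => hy.2 (mem_of_mem_erase h)
    rw [← hf S hS hSN x hx.1 y (mem_sdiff.2 ⟨hS' hy.1, hy.2⟩)]
    refine ih _ (insert_subset (hS' hy.1) ((erase_subset _ _).trans hS)) ?_ ?_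
    · rw [card_insert_of_notMem hy', card_erase_add_one hx.1, hSN]
    · rw [insert_sdiff_of_mem _ hy.1, erase_sdiff_comm, card_erase_of_mem (mem_sdiff.2 hx), h]
      rfl

theorem resampleGen_congr (Λ : Finset V) (w : V → ℝ) (N : ℕ) {f g : Finset V → ℝ}
    (h : ∀ S ∈ subsetsBelow Λ N 0, f S = g S) {S : Finset V} (hS : S ∈ subsetsBelow Λ N 0) :
    resampleGen Λ w f S = resampleGen Λ w g S := by
  rw [resampleGen_apply, resampleGen_apply]
  refine sum_congr rfl fun x hx => ?_
  rw [resampleDev, resampleDev, condMean, condMean, h S hS]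
  congr 2
  refine sum_congr rfl fun y hy => ?_
  rw [h]
  rw [mem_subsetsBelow] at hS ⊢
  rw [mem_sdiff] at hy
  refine ⟨insert_subset hy.1 ((erase_subset _ _).trans hS.1), ?_⟩
  rw [card_insert_of_notMem hy.2, card_erase_add_one hx, ← hS.2, add_zero]

theorem eq_of_resampleGen_eq_zero (Λ : Finset V) (w : V → ℝ) (hw : ∀ x, 0 < w x) (N : ℕ)
    (f : Finset V → ℝ) (hf : ∀ S ∈ subsetsBelow Λ N 0, resampleGen Λ w f S = 0)
    {S S' : Finset V} (hS : S ∈ subsetsBelow Λ N 0) (hS' : S' ∈ subsetsBelow Λ N 0) :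
    f S = f S' := by
  have hμ : ∀ S : Finset V, 0 < ∏ z ∈ S, w z := fun S => prod_pos fun z _ => hw z
  have h := sum_prod_mul_resampleGen Λ w hw N 0 f f
  rw [sum_eq_zero fun S hS => by rw [hf S hS, mul_zero, mul_zero]] at h
  have hdev : ∀ S ∈ subsetsBelow Λ N 0, ∀ x ∈ S, resampleDev Λ w f S x = 0 := by
    intro S hS x hx
    have h₁ := (sum_eq_zero_iff_of_nonneg fun S _ => mul_nonneg (hμ S).le
      (sum_nonneg fun x _ => mul_self_nonneg (resampleDev Λ w f S x))).1 h.symm S hS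
    have h₂ := (mul_eq_zero.1 h₁).resolve_left (hμ S).ne'
    exact mul_self_eq_zero.1
      ((sum_eq_zero_iff_of_nonneg fun x _ => mul_self_nonneg (resampleDev Λ w f S x)).1 h₂ x hx)
  rw [mem_subsetsBelow] at hS hS'
  refine eq_of_forall_exchange Λ N f (fun S hS hSN x hx y hy => ?_) S S' hS.1 hS.2 hS'.1 hS'.2
  rw [mem_sdiff] at hy
  have hy' : y ∉ S.erase x := fun h => hy.2 (mem_of_mem_erase h)
  have h₁ := hdev S (mem_subsetsBelow.2 ⟨hS, hSN⟩) x hx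
  have h₂ := hdev (insert y (S.erase x)) (mem_subsetsBelow.2
    ⟨insert_subset hy.1 ((erase_subset _ _).trans hS), by
      rw [card_insert_of_notMem hy', card_erase_add_one hx, hSN]⟩) y
    (mem_insert_self _ _)
  rw [resampleDev, erase_insert hy'] at h₂
  rw [resampleDev] at h₁
  linarith

/-- The resampling dynamics has spectral gap at least one. -/
theorem exists_sum_sq_sub_le (Λ : Finset V) (w : V → ℝ) (hw : ∀ x, 0 < w x) (N : ℕ)
    (f : Finset V → ℝ) :
    ∃ a : ℝ, ∑ S ∈ subsetsBelow Λ N 0, (∏ z ∈ S, w z) * (f S - a) ^ 2 ≤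
      ∑ S ∈ subsetsBelow Λ N 0, (∏ z ∈ S, w z) * ∑ x ∈ S, resampleDev Λ w f S x ^ 2 := by
  have hμ : ∀ S : Finset V, 0 < ∏ z ∈ S, w z := fun S => prod_pos fun z _ => hw z
  let P := subsetsBelow Λ N 0
  let ext : (P → ℝ) →ₗ[ℝ] (Finset V → ℝ) := Function.ExtendByZero.linearMap ℝ Subtype.val
  have hext : ∀ (u : P → ℝ) (S : P), ext u S = u S := fun u S =>
    Subtype.val_injective.extend_apply u 0 S
  let L : (P → ℝ) →ₗ[ℝ] (P → ℝ) :=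
    LinearMap.funLeft ℝ ℝ Subtype.val ∘ₗ resampleGen Λ w ∘ₗ ext
  have hL : ∀ (u : P → ℝ) (S : P), L u S = resampleGen Λ w (ext u) S := fun _ _ => rfl
  let b : (P → ℝ) →ₗ[ℝ] (P → ℝ) →ₗ[ℝ] ℝ :=
    LinearMap.mk₂ ℝ (fun u v => ∑ S : P, (∏ z ∈ S.1, w z) * (u S * v S))
      (fun u u' v => by simp only [Pi.add_apply, add_mul, mul_add, sum_add_distrib])
      (fun c u v => by
        simp only [Pi.smul_apply, smul_eq_mul, mul_sum]
        exact sum_congr rfl fun _ _ => by ring)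
      (fun u v v' => by simp only [Pi.add_apply, mul_add, sum_add_distrib])
      (fun c u v => by
        simp only [Pi.smul_apply, smul_eq_mul, mul_sum]
        exact sum_congr rfl fun _ _ => by ring)
  have hb : ∀ u v, b u v = ∑ S : P, (∏ z ∈ S.1, w z) * (u S * v S) := fun _ _ => rfl
  have hbL : ∀ u v, b u (L v) = ∑ S ∈ P, (∏ z ∈ S, w z) *
      ∑ x ∈ S, resampleDev Λ w (ext u) S x * resampleDev Λ w (ext v) S x := by
    intro u v
    rw [← sum_prod_mul_resampleGen Λ w hw, hb, ← sum_coe_sort P]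
    simp only [hext, hL]
  have hbsymm : ∀ u v, b u v = b v u := fun u v => by simp only [hb, mul_comm (u _)]
  have hdef : ∀ u, b u u = 0 → u = 0 := by
    intro u hu
    rw [hb] at hu
    ext S
    have h₁ := (sum_eq_zero_iff_of_nonneg fun S _ => mul_nonneg (hμ S.1).le
      (mul_self_nonneg (u S))).1 hu S (mem_univ S)
    exact mul_self_eq_zero.1 ((mul_eq_zero.1 h₁).resolve_left (hμ S.1).ne')
  have hsymm : ∀ u v, b u (L v) = b (L u) v := by
    intro u v
    rw [hbsymm (L u) v, hbL, hbL]
    simp only [mul_comm]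
  have hnonneg : ∀ u, 0 ≤ b u (L u) := by
    intro u
    rw [hbL]
    exact sum_nonneg fun S _ => mul_nonneg (hμ S).le (sum_nonneg fun x _ => mul_self_nonneg _)
  have hsq : ∀ u, b u (L u) ≤ b (L u) (L u) := by
    intro u
    rw [hbL, hb]
    refine (sum_prod_mul_resampleDev_sq_le Λ w hw N 0 (ext u)).trans_eq ?_
    rw [← sum_coe_sort]
    rfl
  obtain ⟨k, hk, hle⟩ := exists_ker_form_sub_le b L hdef hsymm hnonneg hsq (fun S : P => f S)
  have hconst : ∃ a, ∀ S : P, k S = a := by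
    rcases isEmpty_or_nonempty P with hP | ⟨⟨S₀⟩⟩
    · exact ⟨0, fun S => hP.elim S⟩
    · refine ⟨k S₀, fun S => ?_⟩
      rw [← hext k S, ← hext k S₀]
      refine eq_of_resampleGen_eq_zero Λ w hw N (ext k) (fun S hS => ?_) S.2 S₀.2
      exact congrFun hk ⟨S, hS⟩
  obtain ⟨a, ha⟩ := hconst
  refine ⟨a, ?_⟩
  have hf : ∀ S ∈ P, ext (fun S : P => f S) S = f S := fun S hS => hext _ ⟨S, hS⟩
  have h₁ : b ((fun S : P => f S) - k) ((fun S : P => f S) - k) =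
      ∑ S ∈ P, (∏ z ∈ S, w z) * (f S - a) ^ 2 := by
    rw [hb, ← sum_coe_sort P]
    simp only [Pi.sub_apply, ha, sq]
  have h₂ : b (fun S : P => f S) (L fun S : P => f S) =
      ∑ S ∈ P, (∏ z ∈ S, w z) * ∑ x ∈ S, resampleDev Λ w f S x ^ 2 := by
    simp only [sq]
    rw [← sum_prod_mul_resampleGen Λ w hw, hb, ← sum_coe_sort P]
    refine sum_congr rfl fun S _ => ?_
    rw [hL, resampleGen_congr Λ w N hf S.2]
  rw [h₁, h₂] at hle
  exact hle

theorem exchV_eq_insert_erase {x y : V} {S : Finset V} (hx : x ∈ S) (hy : y ∉ S.erase x) :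
    exchV x y S = insert y (S.erase x) := by
  unfold exchV
  conv_lhs => rw [← insert_erase hx]
  rw [image_insert, Equiv.swap_apply_left]
  congr 1
  conv_rhs => rw [← image_id (s := S.erase x)]
  refine image_congr fun z hz => ?_
  exact Equiv.swap_apply_of_ne_of_ne (ne_of_mem_erase hz) fun h => hy (h ▸ hz)

theorem resampleDev_sq_le (Λ : Finset V) (w : V → ℝ) (hw : ∀ x, 0 < w x) (f : Finset V → ℝ)
    {S : Finset V} (hS : S ⊆ Λ) {x : V} (hx : x ∈ S) {M m : ℝ} (hM : ∀ y ∈ Λ, w y ≤ M)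
    (hm : 0 < m) (hmw : m ≤ ∑ y ∈ Λ \ S.erase x, w y) :
    resampleDev Λ w f S x ^ 2 ≤ M / m * ∑ y ∈ Λ, gradV x y f S ^ 2 := by
  set A := Λ \ S.erase x
  set W := ∑ y ∈ A, w y
  have hM0 : 0 ≤ M := (hw x).le.trans (hM x (hS hx))
  have hW : 0 < W := hm.trans_le hmw
  have hdev : resampleDev Λ w f S x * W = - ∑ y ∈ A, w y * gradV x y f S := by
    have hcm : condMean Λ w f (S.erase x) * W = ∑ y ∈ A, w y * f (insert y (S.erase x)) :=
      div_mul_cancel₀ _ hW.ne'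
    rw [resampleDev, sub_mul, hcm, mul_sum, ← sum_sub_distrib, ← sum_neg_distrib]
    refine sum_congr rfl fun y hy => ?_
    rw [gradV, exchV_eq_insert_erase hx (mem_sdiff.1 hy).2]
    ring
  have hcs : (∑ y ∈ A, w y * gradV x y f S) ^ 2 ≤ W * ∑ y ∈ A, w y * gradV x y f S ^ 2 :=
    sum_sq_le_sum_mul_sum_of_sq_le_mul A (fun y _ => (hw y).le)
      (fun y _ => mul_nonneg (hw y).le (sq_nonneg _)) fun y _ => by
        rw [mul_pow, sq (w y), mul_assoc]
  have hbd : ∑ y ∈ A, w y * gradV x y f S ^ 2 ≤ M * ∑ y ∈ Λ, gradV x y f S ^ 2 := by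
    rw [mul_sum]
    refine (sum_le_sum fun y hy => mul_le_mul_of_nonneg_right (hM y (mem_sdiff.1 hy).1)
      (sq_nonneg _)).trans (sum_le_sum_of_subset_of_nonneg sdiff_subset fun y _ _ =>
        mul_nonneg hM0 (sq_nonneg _))
  have hD : 0 ≤ ∑ y ∈ Λ, gradV x y f S ^ 2 := sum_nonneg fun _ _ => sq_nonneg _
  have h₁ : resampleDev Λ w f S x ^ 2 * W ≤ M * ∑ y ∈ Λ, gradV x y f S ^ 2 := by
    refine le_trans ?_ hbd
    refine le_of_mul_le_mul_left ?_ hW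
    calc W * (resampleDev Λ w f S x ^ 2 * W) = (resampleDev Λ w f S x * W) ^ 2 := by ring
      _ ≤ _ := by rw [hdev, neg_sq]; exact hcs
  rw [div_mul_eq_mul_div, le_div_iff₀ hm]
  exact (mul_le_mul_of_nonneg_left hmw (sq_nonneg _)).trans h₁

theorem cE_mono {Λ : Finset V} (α : V → ℝ) {N : ℕ} {g h : Finset V → ℝ}
    (hgh : ∀ S ∈ Λ.powersetCard N, g S ≤ h S) : cE Λ α N g ≤ cE Λ α N h :=
  div_le_div_of_nonneg_right
    (sum_le_sum fun S hS => mul_le_mul_of_nonneg_left (hgh S hS) (Real.exp_pos _).le)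
    (sum_nonneg fun _ _ => (Real.exp_pos _).le)

theorem cE_const_mul (Λ : Finset V) (α : V → ℝ) (N : ℕ) (c : ℝ) (g : Finset V → ℝ) :
    cE Λ α N (fun S => c * g S) = c * cE Λ α N g := by
  unfold cE
  simp only [mul_left_comm _ c, ← mul_sum]
  rw [mul_div_assoc]

theorem cVar_le_cE_sub_sq {Λ : Finset V} (α : V → ℝ) {N : ℕ} (hN : N ≤ Λ.card)
    (f : Finset V → ℝ) (a : ℝ) : cVar Λ α N f ≤ cE Λ α N fun S => (f S - a) ^ 2 := by
  have hZ := partition_pos α hN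
  set Z := ∑ S ∈ Λ.powersetCard N, Real.exp (∑ x ∈ S, α x) with hZdef
  set m := cE Λ α N f with hm
  have hmZ : ∑ S ∈ Λ.powersetCard N, Real.exp (∑ x ∈ S, α x) * f S = m * Z :=
    (div_mul_cancel₀ _ hZ.ne').symm
  refine div_le_div_of_nonneg_right ?_ hZ.le
  rw [← sub_nonneg, ← sum_sub_distrib]
  have : ∑ S ∈ Λ.powersetCard N, (Real.exp (∑ x ∈ S, α x) * (f S - a) ^ 2 -
      Real.exp (∑ x ∈ S, α x) * (f S - m) ^ 2) = (m - a) ^ 2 * Z := by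
    calc _ = 2 * (m - a) * ∑ S ∈ Λ.powersetCard N, Real.exp (∑ x ∈ S, α x) * f S
          + (a ^ 2 - m ^ 2) * Z := by
          rw [hZdef, mul_sum, mul_sum, ← sum_add_distrib]
          exact sum_congr rfl fun S _ => by ring
      _ = _ := by rw [hmZ]; ring
  rw [this]
  positivity

theorem cVar_le_of_two_mul_le {Λ : Finset V} {α : V → ℝ} {B : ℝ} (hα : ∀ x ∈ Λ, |α x| ≤ B)
    {N : ℕ} (hN : 2 * N ≤ Λ.card) (f : Finset V → ℝ) :
    cVar Λ α N f ≤ 2 * Real.exp (2 * B) * (Λ.card : ℝ)⁻¹ *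
      cE Λ α N (fun S => ∑ x ∈ Λ, ∑ y ∈ Λ, gradV x y f S ^ 2) := by
  have hw : ∀ x, 0 < Real.exp (α x) := fun x => Real.exp_pos _
  obtain ⟨a, ha⟩ := exists_sum_sq_sub_le Λ (fun x => Real.exp (α x)) hw N f
  rw [subsetsBelow_zero] at ha
  simp only [← Real.exp_sum] at ha
  have hgap : cVar Λ α N f ≤
      cE Λ α N fun S => ∑ x ∈ S, resampleDev Λ (fun x => Real.exp (α x)) f S x ^ 2 :=
    (cVar_le_cE_sub_sq α (by omega) f a).trans
      (div_le_div_of_nonneg_right ha (partition_pos α (by omega)).le)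
  rw [← cE_const_mul]
  refine hgap.trans (cE_mono α fun S hS => ?_)
  rw [mem_powersetCard] at hS
  rw [mul_sum]
  refine le_trans (sum_le_sum fun x hx => ?_) (sum_le_sum_of_subset_of_nonneg hS.1 fun x _ _ => ?_)
  · have hn : 0 < (Λ.card : ℝ) := by exact_mod_cast card_pos.2 ⟨x, hS.1 hx⟩
    have hcard : (Λ.card : ℝ) ≤ 2 * ((Λ \ S.erase x).card : ℝ) := by
      have h₁ := card_sdiff_add_card_eq_card ((erase_subset x S).trans hS.1)
      have h₂ := card_erase_add_one hx
      exact_mod_cast (by omega : Λ.card ≤ 2 * (Λ \ S.erase x).card)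
    have hm : Real.exp (-B) * (Λ.card / 2) ≤ ∑ y ∈ Λ \ S.erase x, Real.exp (α y) := by
      calc Real.exp (-B) * (Λ.card / 2) ≤ Real.exp (-B) * ((Λ \ S.erase x).card : ℝ) := by
            gcongr; linarith
        _ = ∑ y ∈ Λ \ S.erase x, Real.exp (-B) := by rw [sum_const, nsmul_eq_mul, mul_comm]
        _ ≤ _ := sum_le_sum fun y hy => Real.exp_le_exp.2
            (abs_le.1 (hα y (mem_sdiff.1 hy).1)).1
    refine (resampleDev_sq_le Λ (fun x => Real.exp (α x)) hw f hS.1 hx (M := Real.exp B)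
      (fun y hy => Real.exp_le_exp.2 (abs_le.1 (hα y hy)).2) (by positivity) hm).trans_eq ?_
    congr 1
    rw [Real.exp_neg, two_mul B, Real.exp_add]
    field_simp
  · positivity

/-- Particle-hole symmetry. -/
theorem cE_compl {Λ : Finset V} (α : V → ℝ) {N : ℕ} (hN : N ≤ Λ.card) (g : Finset V → ℝ) :
    cE Λ α N g = cE Λ (fun x => -α x) (Λ.card - N) fun S => g (Λ \ S) := by
  have key : ∀ h : Finset V → ℝ, ∑ S ∈ Λ.powersetCard N, Real.exp (∑ x ∈ S, α x) * h S =
      Real.exp (∑ x ∈ Λ, α x) * ∑ S ∈ Λ.powersetCard (Λ.card - N),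
        Real.exp (∑ x ∈ S, -α x) * h (Λ \ S) := by
    intro h
    rw [mul_sum]
    refine sum_bij' (fun S _ => Λ \ S) (fun S _ => Λ \ S) ?_ ?_ ?_ ?_ ?_
    · intro S hS
      rw [mem_powersetCard] at hS ⊢
      exact ⟨sdiff_subset, by rw [card_sdiff_of_subset hS.1, hS.2]⟩
    · intro S hS
      rw [mem_powersetCard] at hS ⊢
      exact ⟨sdiff_subset, by rw [card_sdiff_of_subset hS.1, hS.2]; omega⟩
    · intro S hS
      exact Finset.sdiff_sdiff_eq_self (mem_powersetCard.1 hS).1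
    · intro S hS
      exact Finset.sdiff_sdiff_eq_self (mem_powersetCard.1 hS).1
    · intro S hS
      have hS' := (mem_powersetCard.1 hS).1
      rw [Finset.sdiff_sdiff_eq_self hS', ← mul_assoc, ← Real.exp_add, sum_neg_distrib,
        ← sum_sdiff hS']
      congr 2
      ring
  have key1 := key fun _ => 1
  simp only [mul_one] at key1
  unfold cE
  rw [key, key1, mul_div_mul_left _ _ (Real.exp_pos _).ne']

theorem exchV_sdiff {Λ : Finset V} {x y : V} (hx : x ∈ Λ) (hy : y ∈ Λ) (S : Finset V) :
    exchV x y (Λ \ S) = Λ \ exchV x y S := by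
  have hΛ : Λ.image (Equiv.swap x y) = Λ := by
    refine eq_of_subset_of_card_le (image_subset_iff.2 fun z hz => ?_)
      (card_image_of_injective _ (Equiv.injective _)).ge
    rw [Equiv.swap_apply_def]
    split_ifs <;> assumption
  unfold exchV
  rw [image_sdiff _ _ (Equiv.injective _), hΛ]

theorem cVar_compl {Λ : Finset V} (α : V → ℝ) {N : ℕ} (hN : N ≤ Λ.card) (f : Finset V → ℝ) :
    cVar Λ α N f = cVar Λ (fun x => -α x) (Λ.card - N) fun S => f (Λ \ S) := by
  unfold cVar
  rw [cE_compl α hN, cE_compl α hN]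

theorem cE_gradV_compl {Λ : Finset V} (α : V → ℝ) {N : ℕ} (hN : N ≤ Λ.card)
    (f : Finset V → ℝ) :
    cE Λ α N (fun S => ∑ x ∈ Λ, ∑ y ∈ Λ, gradV x y f S ^ 2) =
      cE Λ (fun x => -α x) (Λ.card - N)
        (fun S => ∑ x ∈ Λ, ∑ y ∈ Λ, gradV x y (fun S => f (Λ \ S)) S ^ 2) := by
  rw [cE_compl α hN]
  congr 1
  ext S
  refine sum_congr rfl fun x hx => sum_congr rfl fun y hy => ?_
  rw [gradV, gradV, exchV_sdiff hx hy]

end SpectralGap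

theorem stmt_4 (d : ℕ) (B : ℝ) (hB : 0 ≤ B) :
    ∃ C : ℝ, ∀ (Λ : Finset (Fin d → ℤ)) (α : (Fin d → ℤ) → ℝ),
      (∀ x ∈ Λ, |α x| ≤ B) → ∀ N : ℕ, N ≤ Λ.card → ∀ f : Finset (Fin d → ℤ) → ℝ,
        cVar Λ α N f ≤ C * ((Λ.card : ℝ))⁻¹ *
          cE Λ α N (fun S => ∑ x ∈ Λ, ∑ y ∈ Λ, (gradV x y f S) ^ 2) := by
  refine ⟨2 * Real.exp (2 * B), fun Λ α hα N hN f => ?_⟩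
  rcases le_total (2 * N) Λ.card with h | h
  · exact cVar_le_of_two_mul_le hα h f
  · rw [cVar_compl α hN, cE_gradV_compl α hN]
    exact cVar_le_of_two_mul_le (fun x hx => by rw [abs_neg]; exact hα x hx) (by omega) _
end
end
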